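/- Let π₁ : ℝⁿ → ℝ be orthogonal projection onto the first coordinate. Let 𝒞 ⊆ ℝⁿ be compact, and let 𝒞̃ ⊆ ℝⁿ be compact with 𝒞 contained in the interior of 𝒞̃. Then for any K > 0 and ε > 0 there exist C^∞ functions f₁, f₂ : ℝⁿ → ℝ such that: (1) for every x ∈ 𝒞, max(|∂₁∂₁f₁(x)|, |∂₁∂₁f₂(x)|) > 2K; (2) for every x ∈ ℝⁿ, max(|∂₁∂₁f₁(x)|, |∂₁∂₁f₂(x)|) ≤ 4K; (3) for every j ∈ {1,…,n}, every k ∈ {2,…,n}, every i ∈ {1,2}, and every x ∈ ℝⁿ, |∂ⱼ∂ₖfᵢ(x)| < ε, and moreover sup |fᵢ| < ε and sup_x |∂ⱼfᵢ(x)| < ε for all j; (4) f₁ = f₂ = 0 on ℝⁿ ∖ 𝒞̃. -/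

import Mathlib

/-- The partial derivative of `f : ℝⁿ → ℝ` in the `j`-th coordinate direction. -/
noncomputable def partialDeriv1 {n : ℕ} (j : Fin n)
    (f : EuclideanSpace ℝ (Fin n) → ℝ) : EuclideanSpace ℝ (Fin n) → ℝ :=
  fun x => fderiv ℝ f x (EuclideanSpace.single j 1)

open scoped ContDiff in
lemma pd_contDiff {n : ℕ} (j : Fin n) {f : EuclideanSpace ℝ (Fin n) → ℝ}
    (hf : ContDiff ℝ ∞ f) : ContDiff ℝ ∞ (partialDeriv1 j f) := by
  unfold partialDeriv1
  exact (hf.fderiv_right (m := ∞) (by simp)).clm_apply contDiff_const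

lemma pd_compact {n : ℕ} (j : Fin n) {f : EuclideanSpace ℝ (Fin n) → ℝ}
    (hf : HasCompactSupport f) : HasCompactSupport (partialDeriv1 j f) :=
  hf.fderiv_apply (𝕜 := ℝ) _

lemma pd_const_mul {n : ℕ} (j : Fin n) (c : ℝ) {f : EuclideanSpace ℝ (Fin n) → ℝ}
    (hf : Differentiable ℝ f) (x : EuclideanSpace ℝ (Fin n)) :
    partialDeriv1 j (fun x => c * f x) x = c * partialDeriv1 j f x := by
  have h := ((hf x).hasFDerivAt.const_mul c).fderiv
  simp [partialDeriv1, h]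

lemma pd_trig {n : ℕ} [NeZero n] (j : Fin n) (N θ : ℝ)
    {a b : EuclideanSpace ℝ (Fin n) → ℝ}
    (ha : Differentiable ℝ a) (hb : Differentiable ℝ b) (x : EuclideanSpace ℝ (Fin n)) :
    partialDeriv1 j (fun x => a x * Real.sin (N * x 0 + θ) + b x * Real.cos (N * x 0 + θ)) x
      = (partialDeriv1 j a x - N * (if j = 0 then 1 else 0) * b x) * Real.sin (N * x 0 + θ)
        + (partialDeriv1 j b x + N * (if j = 0 then 1 else 0) * a x)
          * Real.cos (N * x 0 + θ) := by
  have hl : HasFDerivAt (fun x : EuclideanSpace ℝ (Fin n) => N * x 0 + θ)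
      (N • (EuclideanSpace.proj 0 : EuclideanSpace ℝ (Fin n) →L[ℝ] ℝ)) x :=
    ((EuclideanSpace.proj 0 : EuclideanSpace ℝ (Fin n) →L[ℝ] ℝ).hasFDerivAt.const_mul N).add_const θ
  have h := (((ha x).hasFDerivAt.mul hl.sin).add ((hb x).hasFDerivAt.mul hl.cos)).fderiv
  have h' : fderiv ℝ (fun x => a x * Real.sin (N * x 0 + θ) + b x * Real.cos (N * x 0 + θ)) x = _ := h
  have e : (EuclideanSpace.single j (1:ℝ) : EuclideanSpace ℝ (Fin n)) 0 = if j = 0 then 1 else 0 := by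
    simp [Pi.single_apply, eq_comm]
  simp only [partialDeriv1, h']
  simp only [add_apply, smul_apply, smul_eq_mul,
    PiLp.proj_apply, e]
  ring

lemma abs_bound {a s M : ℝ} (ha : |a| ≤ M) (hs : |s| ≤ 1) : |a * s| ≤ M := by
  rw [abs_mul]
  nlinarith [abs_nonneg a, abs_nonneg s]

open scoped ContDiff in
/-- The basic estimates for one oscillating function. -/
lemma one_function {n : ℕ} [NeZero n] (χ : EuclideanSpace ℝ (Fin n) → ℝ)
    (hχ : ContDiff ℝ ∞ χ) (A M N θ : ℝ) (hA : 0 < A) (hN : 1 ≤ N)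
    (h0 : ∀ x, |χ x| ≤ M) (h1 : ∀ j x, |partialDeriv1 j χ x| ≤ M)
    (h2 : ∀ j k x, |partialDeriv1 j (partialDeriv1 k χ) x| ≤ M)
    (f : EuclideanSpace ℝ (Fin n) → ℝ)
    (hf : f = fun x => A / N ^ 2 * χ x * Real.sin (N * x 0 + θ)) :
    ContDiff ℝ ∞ f ∧ (∀ x, |f x| ≤ 3 * A * M / N) ∧ (∀ j x, |partialDeriv1 j f x| ≤ 3 * A * M / N) ∧
    (∀ j k, k ≠ 0 → ∀ x, |partialDeriv1 j (partialDeriv1 k f) x| ≤ 3 * A * M / N) ∧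
    (∀ x, |partialDeriv1 0 (partialDeriv1 0 f) x + A * (χ x * Real.sin (N * x 0 + θ))|
      ≤ 3 * A * M / N) := by
  have hN0 : 0 < N := by linarith
  have hM : 0 ≤ M := (abs_nonneg _).trans (h0 0)
  have dχ := hχ.differentiable (by simp)
  have dχ' := fun k => (pd_contDiff k hχ).differentiable (by simp)
  set c := A / N ^ 2 with hc
  have hcA : c * N ^ 2 = A := by rw [hc]; field_simp
  have hc0 : 0 < c := by positivity
  have e1 : ∀ k, partialDeriv1 k f = fun x =>
      (c * partialDeriv1 k χ x) * Real.sin (N * x 0 + θ)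
        + ((c * N * (if k = 0 then 1 else 0)) * χ x) * Real.cos (N * x 0 + θ) := by
    intro k
    funext x
    have := pd_trig k N θ (a := fun x => c * χ x) (b := fun _ => (0:ℝ) * χ 0) (dχ.const_mul c)
      (differentiable_const _) x
    have hz : f = fun x => (c * χ x) * Real.sin (N * x 0 + θ)
        + (0 * χ 0) * Real.cos (N * x 0 + θ) := by
      rw [hf]; funext x; ring
    rw [hz, this, pd_const_mul k c dχ]
    simp [partialDeriv1]
    ring
  have e2 : ∀ j k x, partialDeriv1 j (partialDeriv1 k f) x =
      c * (partialDeriv1 j (partialDeriv1 k χ) x * Real.sin (N * x 0 + θ))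
      - c * N ^ 2 * ((if j = 0 then 1 else 0) * (if k = 0 then 1 else 0))
          * (χ x * Real.sin (N * x 0 + θ))
      + c * N * (if k = 0 then 1 else 0) * (partialDeriv1 j χ x * Real.cos (N * x 0 + θ))
      + c * N * (if j = 0 then 1 else 0) * (partialDeriv1 k χ x * Real.cos (N * x 0 + θ)) := by
    intro j k x
    rw [e1 k, pd_trig j N θ ((dχ' k).const_mul c) (dχ.const_mul _),
      pd_const_mul j _ (dχ' k), pd_const_mul j _ dχ]
    ring
  have S : ∀ x : EuclideanSpace ℝ (Fin n), |Real.sin (N * x 0 + θ)| ≤ 1 :=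
    fun x => Real.abs_sin_le_one _
  have T : ∀ x : EuclideanSpace ℝ (Fin n), |Real.cos (N * x 0 + θ)| ≤ 1 :=
    fun x => Real.abs_cos_le_one _
  have hB : 3 * A * M / N = 3 * (c * N * M) := by rw [← hcA]; field_simp
  have hcN : c * M ≤ c * N * M := by nlinarith [mul_nonneg hc0.le hM]
  have bs : ∀ {u v : ℝ}, |u| ≤ M → |v| ≤ 1 → |c * (u * v)| ≤ c * N * M := by
    intro u v hu hv
    rw [abs_mul, abs_of_pos hc0]
    exact (mul_le_mul_of_nonneg_left (abs_bound hu hv) hc0.le).trans hcN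
  have bc : ∀ {u v : ℝ}, |u| ≤ M → |v| ≤ 1 → |c * N * (u * v)| ≤ c * N * M := by
    intro u v hu hv
    rw [abs_mul, abs_of_pos (by positivity : 0 < c * N)]
    exact mul_le_mul_of_nonneg_left (abs_bound hu hv) (by positivity)
  have hp : 0 ≤ c * N * M := by positivity
  rw [hB]
  refine ⟨?_, ?_, ?_, ?_, ?_⟩
  · rw [hf]
    have hx0 : ContDiff ℝ ∞ (fun x : EuclideanSpace ℝ (Fin n) => x 0) :=
      (EuclideanSpace.proj 0 : EuclideanSpace ℝ (Fin n) →L[ℝ] ℝ).contDiff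
    exact (contDiff_const.mul hχ).mul ((contDiff_const.mul hx0).add contDiff_const).sin
  · intro x
    have := bs (h0 x) (S x)
    rw [hf]
    simp only
    rw [mul_assoc]
    linarith
  · intro j x
    rw [e1 j]
    have b1 := abs_le.1 (bs (h1 j x) (S x))
    have b2 := abs_le.1 (bc (h0 x) (T x))
    rw [abs_le]
    by_cases hj : j = 0 <;> simp only [hj, if_true, if_false] at b1 ⊢ <;>
      constructor <;> linarith [b1.1, b1.2, b2.1, b2.2]
  · intro j k hk x
    rw [e2 j k]
    have b1 := abs_le.1 (bs (h2 j k x) (S x))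
    have b2 := abs_le.1 (bc (h1 k x) (T x))
    rw [abs_le]
    by_cases hj : j = 0 <;> simp only [hj, hk, if_true, if_false] at b1 ⊢ <;>
      constructor <;> linarith [b1.1, b1.2, b2.1, b2.2]
  · intro x
    rw [e2 0 0]
    have b1 := abs_le.1 (bs (h2 0 0 x) (S x))
    have b2 := abs_le.1 (bc (h1 0 x) (T x))
    rw [abs_le]
    simp only [if_true]
    rw [hcA]
    constructor <;> linarith [b1.1, b1.2, b2.1, b2.2]

open scoped ContDiff Manifold in
lemma exists_cutoff {n : ℕ} (C Ct : Set (EuclideanSpace ℝ (Fin n)))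
    (hC : IsCompact C) (hCt : IsCompact Ct) (hsub : C ⊆ interior Ct) :
    ∃ χ : EuclideanSpace ℝ (Fin n) → ℝ, ContDiff ℝ ∞ χ ∧ (∀ x ∈ C, χ x = 1) ∧
      (∀ x ∉ Ct, χ x = 0) ∧ (∀ x, |χ x| ≤ 1) ∧ HasCompactSupport χ := by
  obtain ⟨f, h1, h0, h⟩ := exists_contMDiffMap_one_nhds_of_subset_interior (n := (⊤ : ℕ∞))
    𝓘(ℝ, EuclideanSpace ℝ (Fin n)) hC.isClosed hsub
  refine ⟨f, f.contMDiff.contDiff, fun x hx => h1.self_of_nhdsSet x hx, h0, fun x => ?_, ?_⟩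
  · rw [abs_le]
    constructor <;> linarith [(h x).1, (h x).2]
  · exact HasCompactSupport.intro hCt h0

lemma exists_bd {n : ℕ} {f : EuclideanSpace ℝ (Fin n) → ℝ}
    (hf : Continuous f) (hc : HasCompactSupport f) : ∃ M, ∀ x, |f x| ≤ M :=
  hc.exists_bound_of_continuous hf

/-- Lemma 2 of the paper: given compact sets `𝒞 ⊆ int 𝒞̃` in `ℝⁿ` and `K, ε > 0`,
there are `C^∞` functions `f₁, f₂ : ℝⁿ → ℝ`, vanishing outside `𝒞̃`, with
`max (|∂₁∂₁f₁|) (|∂₁∂₁f₂|) > 2K` on `𝒞` and `≤ 4K` everywhere, while all other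
second partials `∂ⱼ∂ₖfᵢ` (with `k ≠ 1`) are `< ε`, and `sup |fᵢ| < ε`,
`sup |∂ⱼfᵢ| < ε`. (Here the index `0 : Fin n` plays the role of the first
coordinate direction.) -/
theorem exists_perturbation_functions {n : ℕ} [NeZero n]
    (C Ct : Set (EuclideanSpace ℝ (Fin n)))
    (hC : IsCompact C) (hCt : IsCompact Ct) (hsub : C ⊆ interior Ct)
    (K ε : ℝ) (hK : 0 < K) (hε : 0 < ε) :
    ∃ f₁ f₂ : EuclideanSpace ℝ (Fin n) → ℝ,
      ContDiff ℝ (⊤ : ℕ∞) f₁ ∧ ContDiff ℝ (⊤ : ℕ∞) f₂ ∧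
      (∀ x ∈ C,
        2 * K < max |partialDeriv1 0 (partialDeriv1 0 f₁) x|
                    |partialDeriv1 0 (partialDeriv1 0 f₂) x|) ∧
      (∀ x, max |partialDeriv1 0 (partialDeriv1 0 f₁) x|
                |partialDeriv1 0 (partialDeriv1 0 f₂) x| ≤ 4 * K) ∧
      (∀ (j k : Fin n), k ≠ 0 → ∀ x,
          |partialDeriv1 j (partialDeriv1 k f₁) x| < ε ∧
          |partialDeriv1 j (partialDeriv1 k f₂) x| < ε) ∧
      (⨆ x, |f₁ x|) < ε ∧ (⨆ x, |f₂ x|) < ε ∧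
      (∀ j : Fin n,
        (⨆ x, |partialDeriv1 j f₁ x|) < ε ∧ (⨆ x, |partialDeriv1 j f₂ x|) < ε) ∧
      (∀ x ∉ Ct, f₁ x = 0 ∧ f₂ x = 0) := by
  obtain ⟨χ, hχ, hχ1, hχ0, hχb, hχc⟩ := exists_cutoff C Ct hC hCt hsub
  choose M1 hM1 using fun j => exists_bd (pd_contDiff j hχ).continuous (pd_compact j hχc)
  choose M2 hM2 using fun j k => exists_bd (pd_contDiff j (pd_contDiff k hχ)).continuous
    (pd_compact j (pd_compact k hχc))
  obtain ⟨M, hM0, hMa, hMb⟩ : ∃ M : ℝ, 1 ≤ M ∧ (∀ j, M1 j ≤ M) ∧ ∀ j k, M2 j k ≤ M := by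
    obtain ⟨a, ha⟩ := (Set.finite_range M1).bddAbove
    obtain ⟨b, hb⟩ := (Set.finite_range (fun p : Fin n × Fin n => M2 p.1 p.2)).bddAbove
    refine ⟨max 1 (max a b), le_max_left _ _, fun j => ?_, fun j k => ?_⟩
    · exact (ha ⟨j, rfl⟩).trans ((le_max_left _ _).trans (le_max_right _ _))
    · exact (hb ⟨(j, k), rfl⟩).trans ((le_max_right _ _).trans (le_max_right _ _))
  obtain ⟨δ, hδ, hδε, hδK⟩ : ∃ δ : ℝ, 0 < δ ∧ δ < ε ∧ δ ≤ K / 4 :=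
    ⟨min (ε / 2) (K / 4), by positivity, (min_le_left _ _).trans_lt (by linarith), min_le_right _ _⟩
  obtain ⟨A, hA⟩ : ∃ A : ℝ, A = 7 / 2 * K := ⟨_, rfl⟩
  have hA0 : 0 < A := by rw [hA]; positivity
  obtain ⟨N, hN1, hN⟩ : ∃ N : ℝ, 1 ≤ N ∧ 3 * A * M / N ≤ δ := by
    refine ⟨max 1 (3 * A * M / δ), le_max_left _ _, ?_⟩
    rw [div_le_iff₀ (by positivity)]
    have := le_max_right 1 (3 * A * M / δ)
    rw [div_le_iff₀ hδ] at this
    linarith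
  have key := fun θ f hf => one_function χ hχ A M N θ hA0 hN1 (fun x => (hχb x).trans hM0)
    (fun j x => (hM1 j x).trans (hMa j)) (fun j k x => (hM2 j k x).trans (hMb j k)) f hf
  obtain ⟨f₁, hf₁⟩ : ∃ f : EuclideanSpace ℝ (Fin n) → ℝ,
    f = fun x => A / N ^ 2 * χ x * Real.sin (N * x 0 + 0) := ⟨_, rfl⟩
  obtain ⟨f₂, hf₂⟩ : ∃ f : EuclideanSpace ℝ (Fin n) → ℝ,
    f = fun x => A / N ^ 2 * χ x * Real.sin (N * x 0 + Real.pi / 2) := ⟨_, rfl⟩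
  have k1 := key 0 f₁ hf₁
  have k2 := key (Real.pi / 2) f₂ hf₂
  obtain ⟨a1, a2, a3, a4, a5⟩ := k1
  obtain ⟨b1, b2, b3, b4, b5⟩ := k2
  have up : ∀ (x : EuclideanSpace ℝ (Fin n)) (s p : ℝ), |s| ≤ 1 →
      |p + A * (χ x * s)| ≤ 3 * A * M / N → |p| ≤ 4 * K := by
    intro x s p hs h
    have h1 := abs_le.1 (abs_bound (hχb x) hs)
    have h2 := abs_le.1 h
    rw [abs_le]
    constructor <;> nlinarith [h1.1, h1.2, h2.1, h2.2]
  have sup : ∀ g : EuclideanSpace ℝ (Fin n) → ℝ, (∀ x, |g x| ≤ 3 * A * M / N) →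
      (⨆ x, |g x|) < ε := fun g hg => (ciSup_le fun x => (hg x).trans hN).trans_lt hδε
  refine ⟨f₁, f₂, a1, b1, ?_, ?_, ?_, sup _ a2, sup _ b2, fun j => ⟨sup _ (a3 j), sup _ (b3 j)⟩, ?_⟩
  · intro x hx
    have A5 := a5 x
    have B5 := b5 x
    rw [hχ1 x hx, one_mul, add_zero] at A5
    rw [hχ1 x hx, one_mul, Real.sin_add_pi_div_two] at B5
    by_contra hcon
    rw [not_lt, max_le_iff] at hcon
    have low : ∀ s p : ℝ, |p| ≤ 2 * K → |p + A * s| ≤ 3 * A * M / N → s ^ 2 ≤ (9 / 14) ^ 2 := by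
      intro s p hp h
      have h1 := abs_le.1 hp
      have h2 := abs_le.1 h
      have : |s| ≤ 9 / 14 := by
        rw [abs_le]
        constructor <;> by_contra! hh <;> nlinarith [h1.1, h1.2, h2.1, h2.2]
      exact sq_le_sq' (abs_le.1 this).1 (abs_le.1 this).2
    have s1 := low _ _ hcon.1 A5
    have s2 := low _ _ hcon.2 B5
    nlinarith [Real.sin_sq_add_cos_sq (N * x 0)]
  · intro x
    exact max_le (up x _ _ (Real.abs_sin_le_one _) (a5 x)) (up x _ _ (Real.abs_sin_le_one _) (b5 x))
  · intro j k hk x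
    exact ⟨((a4 j k hk x).trans hN).trans_lt hδε, ((b4 j k hk x).trans hN).trans_lt hδε⟩
  · intro x hx
    simp [hf₁, hf₂, hχ0 x hx]
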